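/- arXiv:1409.4960 — 4 statements merged into one kernel-verified Lean document; each statement's English description precedes it below -/
import Mathlib

section
/- Let (X,d) be a complete metric space and let ∅ ≠ D ⊆ X. Let M : D → (0,∞) be bounded on compact subsets of D and fix a real k > 0. If y ∈ D is such that M(y)·dist(y, X∖D) > 2k, then there exists x ∈ D such that M(x)·dist(x, X∖D) > 2k, M(x) ≥ M(y), and M(z) ≤ 2M(x) for every z ∈ D with d(z,x) ≤ k/M(x). -/
open Set

theorem ENNReal.ofReal_lt_ofReal_mul_iff {c m : ℝ} (hm : 0 < m) (e : ENNReal) :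
    ENNReal.ofReal c < ENNReal.ofReal m * e ↔ ENNReal.ofReal (c / m) < e := by
  rw [ENNReal.ofReal_div_of_pos hm, mul_comm,
    ENNReal.div_lt_iff (Or.inl (by simpa using hm)) (Or.inl ENNReal.ofReal_ne_top)]

/-- Doubling Lemma: let `(X,d)` be a complete metric space, `∅ ≠ D ⊆ X`, and
`M : D → (0,∞)` bounded on compact subsets of `D`, `k > 0`. If `y ∈ D` satisfies
`M(y)·dist(y, X∖D) > 2k` (with `dist(·,∅) = +∞`, encoded via the extended
distance `EMetric.infEdist`), then there is `x ∈ D` with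
`M(x)·dist(x, X∖D) > 2k`, `M(x) ≥ M(y)`, and `M(z) ≤ 2 M(x)` whenever
`z ∈ D` and `d(z,x) ≤ k / M(x)`. -/
theorem doubling_lemma {X : Type*} [MetricSpace X] [CompleteSpace X]
    (D : Set X) (hD : D.Nonempty) (M : X → ℝ)
    (hMpos : ∀ x ∈ D, 0 < M x)
    (hMbdd : ∀ K : Set X, K ⊆ D → IsCompact K → ∃ C : ℝ, ∀ x ∈ K, M x ≤ C)
    (k : ℝ) (hk : 0 < k) (y : X) (hy : y ∈ D)
    (hyk : ENNReal.ofReal (2 * k) < ENNReal.ofReal (M y) * EMetric.infEdist y Dᶜ) :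
    ∃ x ∈ D,
      ENNReal.ofReal (2 * k) < ENNReal.ofReal (M x) * EMetric.infEdist x Dᶜ ∧
      M y ≤ M x ∧
      ∀ z ∈ D, dist z x ≤ k / M x → M z ≤ 2 * M x := by
  by_contra! hcon
  let S : Set X := {x | x ∈ D ∧
    ENNReal.ofReal (2 * k) < ENNReal.ofReal (M x) * Metric.infEDist x Dᶜ ∧ M y ≤ M x}
  have step : ∀ x : S, ∃ z : S, dist (x : X) z ≤ k / M x ∧ 2 * M x < M z := by
    rintro ⟨x, hxD, hx, hxy⟩
    obtain ⟨z, hzD, hzx, hMz⟩ := hcon x hxD hx hxy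
    have hMx := hMpos x hxD
    refine ⟨⟨z, hzD, ?_, by linarith⟩, by rwa [dist_comm], hMz⟩
    rw [ENNReal.ofReal_lt_ofReal_mul_iff hMx] at hx
    rw [ENNReal.ofReal_lt_ofReal_mul_iff (hMpos z hzD)]
    have hle : 2 * k / M z ≤ k / M x := by
      rw [div_le_div_iff₀ (hMpos z hzD) hMx]
      nlinarith
    refine (ENNReal.ofReal_le_ofReal hle).trans_lt ?_
    have htri : Metric.infEDist x Dᶜ ≤ Metric.infEDist z Dᶜ + ENNReal.ofReal (k / M x) := by
      refine (Metric.infEDist_le_infEDist_add_edist (y := z)).trans ?_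
      gcongr
      rw [edist_dist, dist_comm]
      exact ENNReal.ofReal_le_ofReal hzx
    have hlt := hx.trans_le htri
    rw [show 2 * k / M x = k / M x + k / M x by ring,
      ENNReal.ofReal_add (by positivity) (by positivity)] at hlt
    exact lt_of_add_lt_add_right hlt
  choose next hdist hdouble using step
  let u : ℕ → S := fun n => next^[n] ⟨y, hy, hyk, le_rfl⟩
  have hu : ∀ n, u (n + 1) = next (u n) := fun n => Function.iterate_succ_apply' _ _ _
  have hMy := hMpos y hy
  have hgrow : ∀ n, 2 ^ n * M y ≤ M (u n) := by
    intro n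
    induction n with
    | zero =>
      change 2 ^ 0 * M y ≤ M y
      simp
    | succ n ih =>
      have := hdouble (u n)
      rw [hu, pow_succ]
      linarith
  have hgeom : ∀ n, dist (u n : X) (u (n + 1)) ≤ 2 * k / M y / 2 / 2 ^ n := by
    intro n
    rw [hu]
    refine (hdist (u n)).trans ?_
    calc k / M (u n) ≤ k / (2 ^ n * M y) := by gcongr; exact hgrow n
      _ = 2 * k / M y / 2 / 2 ^ n := by field_simp
  obtain ⟨a, ha⟩ := cauchySeq_tendsto_of_complete (cauchySeq_of_le_geometric_two hgeom)
  have hya : dist y a ≤ 2 * k / M y := dist_le_of_le_geometric_two_of_tendsto₀ hgeom ha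
  have haD : a ∈ D := by
    by_contra h
    rw [ENNReal.ofReal_lt_ofReal_mul_iff hMy] at hyk
    refine hyk.not_ge ((Metric.infEDist_le_edist_of_mem (mem_compl h)).trans ?_)
    rw [edist_dist]
    exact ENNReal.ofReal_le_ofReal hya
  obtain ⟨C, hC⟩ := hMbdd _ (insert_subset haD (range_subset_iff.2 fun n => (u n).2.1))
    ha.isCompact_insert_range
  obtain ⟨n, hn⟩ := pow_unbounded_of_one_lt (C / M y) one_lt_two
  rw [div_lt_iff₀ hMy] at hn
  exact (hn.trans_le (hgrow n)).not_ge (hC _ (mem_insert_of_mem _ (mem_range_self n)))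
end

section
/- Let p > 1, β > 0 and C > 0, and let y : ℝ → ℝ be differentiable with y(s) > 0 and y'(s) + β·y(s) ≥ C·y(s)^p for all s ∈ ℝ. Then y(s) ≤ (β/C)^{1/(p−1)} for all s ∈ ℝ. -/
open Filter in
/-- A positive global solution of the linear differential inequality `z' ≤ a (z - K)` with `a > 0`
stays above the equilibrium `K`. -/
lemma le_of_deriv_le_mul_sub {a K : ℝ} (ha : 0 < a) {z z' : ℝ → ℝ}
    (hz : ∀ s, HasDerivAt z (z' s) s) (hpos : ∀ s, 0 < z s)
    (hle : ∀ s, z' s ≤ a * (z s - K)) (s : ℝ) : K ≤ z s := by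
  have hg : ∀ t, HasDerivAt (fun t => Real.exp (-(a * t)) * (z t - K))
      (Real.exp (-(a * t)) * (z' t - a * (z t - K))) t := by
    intro t
    have hexp : HasDerivAt (fun t => Real.exp (-(a * t))) (Real.exp (-(a * t)) * (-(a * 1))) t :=
      (((hasDerivAt_id t).const_mul a).neg).exp
    exact (hexp.mul ((hz t).sub_const K)).congr_deriv (by ring)
  have hanti : Antitone fun t => Real.exp (-(a * t)) * (z t - K) :=
    antitone_of_hasDerivAt_nonpos hg fun t =>
      mul_nonpos_of_nonneg_of_nonpos (Real.exp_pos _).le (sub_nonpos.2 (hle t))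
  by_contra! hlt
  have hc : 0 < Real.exp (-(a * s)) * (K - z s) := mul_pos (Real.exp_pos _) (sub_pos.2 hlt)
  have htend : Tendsto (fun t => Real.exp (a * t) * (Real.exp (-(a * s)) * (K - z s)))
      atTop atTop :=
    (Real.tendsto_exp_atTop.comp (tendsto_id.const_mul_atTop ha)).atTop_mul_const hc
  obtain ⟨t, hKt, hst⟩ := ((htend.eventually_ge_atTop K).and (eventually_ge_atTop s)).exists
  have hmul := mul_le_mul_of_nonneg_left (hanti hst) (Real.exp_pos (a * t)).le
  have hinv : Real.exp (a * t) * Real.exp (-(a * t)) = 1 := by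
    rw [← Real.exp_add, add_neg_cancel, Real.exp_zero]
  simp only [← mul_assoc, hinv, one_mul] at hmul hKt
  linarith [hpos t]

/-- ODE comparison: a globally defined positive differentiable function satisfying
`y' + β y ≥ C y^p` on all of `ℝ` (with `p > 1`, `β, C > 0`) cannot exceed the
equilibrium value `(β/C)^{1/(p-1)}`. -/
theorem ode_global_bound
    (p β C : ℝ) (hp : 1 < p) (hβ : 0 < β) (hC : 0 < C)
    (y : ℝ → ℝ) (hdiff : Differentiable ℝ y)
    (hpos : ∀ s : ℝ, 0 < y s)
    (hineq : ∀ s : ℝ, C * y s ^ p ≤ deriv y s + β * y s) :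
    ∀ s : ℝ, y s ≤ (β / C) ^ (1 / (p - 1)) := by
  intro s
  have hp' : 0 < p - 1 := sub_pos.2 hp
  -- The substitution `z = y ^ (1 - p)` makes the inequality linear.
  have hz : ∀ t, HasDerivAt (fun t => y t ^ (1 - p))
      (deriv y t * (1 - p) * y t ^ (1 - p - 1)) t := fun t =>
    (hdiff t).hasDerivAt.rpow_const (Or.inl (hpos t).ne')
  have hle : ∀ t, deriv y t * (1 - p) * y t ^ (1 - p - 1) ≤
      (p - 1) * β * (y t ^ (1 - p) - C / β) := by
    intro t
    have hone : y t ^ p * y t ^ (1 - p - 1) = 1 := by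
      rw [← Real.rpow_add (hpos t)]
      simp
    have hshift : y t ^ (1 - p) = y t * y t ^ (1 - p - 1) := by
      conv_rhs => rw [← Real.rpow_one_add' (hpos t).le (by linarith)]
      congr 1
      ring
    have hcoef : 0 < (p - 1) * y t ^ (1 - p - 1) := mul_pos hp' (Real.rpow_pos_of_pos (hpos t) _)
    have hmul := mul_le_mul_of_nonneg_left (hineq t) hcoef.le
    have hCβ : (p - 1) * β * (y t ^ (1 - p) - C / β) =
        (p - 1) * β * y t ^ (1 - p) - (p - 1) * C := by
      field_simp
    rw [hCβ, hshift]
    linear_combination hmul - (p - 1) * C * hone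
  have hlower : C / β ≤ y s ^ (1 - p) :=
    le_of_deriv_le_mul_sub (mul_pos hp' hβ) hz (fun t => Real.rpow_pos_of_pos (hpos t) _) hle s
  rw [one_div, Real.le_rpow_inv_iff_of_pos (hpos s).le (div_pos hβ hC).le hp', ← inv_div C β]
  rw [← neg_sub, Real.rpow_neg (hpos s).le] at hlower
  exact (le_inv_comm₀ (div_pos hC hβ) (Real.rpow_pos_of_pos (hpos s) _)).1 hlower
end

section
/- Let n ≥ 1, λ > 0 and set T_λ = {x ∈ ℝⁿ : 0 < x₁ < λ}. Let v : closure(T_λ)×ℝ → ℝ be continuous and bounded, twice continuously differentiable in x and once continuously differentiable in t in T_λ×ℝ, satisfying ∂ₜv = Δv in T_λ×ℝ and v ≤ 0 on ∂T_λ×ℝ. Then v ≤ 0 in T_λ×ℝ. -/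
open scoped BigOperators
open Set

/-- The Laplacian of `f : ℝⁿ → ℝ` at `x`, as the sum of the second partial
derivatives in the coordinate directions. -/
noncomputable def lap {n : ℕ} (f : EuclideanSpace ℝ (Fin n) → ℝ)
    (x : EuclideanSpace ℝ (Fin n)) : ℝ :=
  ∑ i : Fin n,
    fderiv ℝ (fun y => fderiv ℝ f y (EuclideanSpace.single i 1)) x
      (EuclideanSpace.single i 1)

open Filter Topology in
/-- A function touched from above at `0` by the parabola `f 0 + b s + c s ^ 2` has second
derivative at most `2 c` there. -/
theorem deriv_deriv_le_of_le_quadratic {f : ℝ → ℝ} {b c : ℝ}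
    (hle : ∀ᶠ s in 𝓝 (0 : ℝ), f s ≤ f 0 + b * s + c * s ^ 2)
    (hd : ∀ᶠ s in 𝓝 (0 : ℝ), DifferentiableAt ℝ f s)
    (hdd : DifferentiableAt ℝ (deriv f) 0) :
    deriv (deriv f) 0 ≤ 2 * c := by
  by_contra! hlt
  set g : ℝ → ℝ := fun s => f s - (b * s + c * s ^ 2) with hg
  have hmax : IsLocalMax g 0 := by
    filter_upwards [hle] with s hs
    simp only [hg]
    linarith
  have hdg : deriv g =ᶠ[𝓝 0] fun s => deriv f s - (b + 2 * c * s) := by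
    filter_upwards [hd] with s hs
    have h1 : HasDerivAt (fun s : ℝ => b * s + c * s ^ 2) (b + 2 * c * s) s := by
      refine (((hasDerivAt_id s).const_mul b).add ((hasDerivAt_pow 2 s).const_mul c)).congr_deriv ?_
      norm_num
      ring
    exact (hs.hasDerivAt.sub h1).deriv
  have hddg : deriv (deriv g) 0 = deriv (deriv f) 0 - 2 * c := by
    rw [hdg.deriv_eq]
    have h1 : HasDerivAt (fun s : ℝ => b + 2 * c * s) (2 * c) 0 := by
      simpa using ((hasDerivAt_id (0 : ℝ)).const_mul (2 * c)).const_add b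
    exact (hdd.hasDerivAt.sub h1).deriv
  have hmin : IsLocalMin g 0 := by
    refine isLocalMin_of_deriv_deriv_pos (by linarith) hmax.deriv_eq_zero ?_
    exact hd.self_of_nhds.continuousAt.sub (by fun_prop)
  have hconst : g =ᶠ[𝓝 0] fun _ => g 0 := by
    filter_upwards [hmax, hmin] with s h1 h2
    exact le_antisymm h1 h2
  have hzero : deriv (deriv g) 0 = 0 := by
    rw [hconst.deriv.deriv_eq]
    simp
  linarith

open Filter Topology in
/-- A `C²` function touched from above at `x` by a quadratic in the direction `e` has second
directional derivative at most twice the quadratic coefficient. -/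
theorem fderiv_fderiv_le_of_le_quadratic {E : Type*} [NormedAddCommGroup E] [NormedSpace ℝ E]
    {f : E → ℝ} {x e : E} {b c : ℝ} (hf : ContDiffAt ℝ 2 f x)
    (hle : ∀ᶠ s in 𝓝 (0 : ℝ), f (x + s • e) ≤ f x + b * s + c * s ^ 2) :
    fderiv ℝ (fun y => fderiv ℝ f y e) x e ≤ 2 * c := by
  have hline : ∀ s : ℝ, HasDerivAt (fun s : ℝ => x + s • e) e s := fun s => by
    simpa using ((hasDerivAt_id s).smul_const e).const_add x
  have htend : Tendsto (fun s : ℝ => x + s • e) (𝓝 0) (𝓝 x) := by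
    simpa using (hline 0).continuousAt.tendsto
  have hdf : ∀ᶠ s in 𝓝 (0 : ℝ), DifferentiableAt ℝ f (x + s • e) :=
    htend.eventually ((hf.eventually (by simp)).mono fun y hy => hy.differentiableAt (by simp))
  have hder : deriv (fun s : ℝ => f (x + s • e)) =ᶠ[𝓝 0] fun s => fderiv ℝ f (x + s • e) e := by
    filter_upwards [hdf] with s hs
    exact (hs.hasFDerivAt.comp_hasDerivAt s (hline s)).deriv
  have hF : DifferentiableAt ℝ (fun y => fderiv ℝ f y e) x :=
    ((hf.fderiv_right (m := 1) (by norm_num)).differentiableAt one_ne_zero).clm_apply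
      (differentiableAt_const e)
  have hF' : HasDerivAt (fun s : ℝ => fderiv ℝ f (x + s • e) e)
      (fderiv ℝ (fun y => fderiv ℝ f y e) x e) 0 := by
    have hF₀ : HasFDerivAt (fun y => fderiv ℝ f y e) (fderiv ℝ (fun y => fderiv ℝ f y e) x)
        (x + (0 : ℝ) • e) := by
      simpa using hF.hasFDerivAt
    exact hF₀.comp_hasDerivAt 0 (hline 0)
  rw [← hF'.deriv, ← hder.deriv_eq]
  refine deriv_deriv_le_of_le_quadratic (b := b) (by simpa using hle) ?_ ?_
  · filter_upwards [hdf] with s hs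
    exact (hs.hasFDerivAt.comp_hasDerivAt s (hline s)).differentiableAt
  · exact hder.differentiableAt_iff.mpr hF'.differentiableAt

/-- A function bounded above, for times before `t`, by an affine function touching it at `t`
has derivative at least the slope. -/
theorem le_deriv_of_le_affine_left {f : ℝ → ℝ} {t c : ℝ} (hf : DifferentiableAt ℝ f t)
    (hle : ∀ s ≤ t, f s ≤ f t + c * (s - t)) : c ≤ deriv f t := by
  have h := hasDerivWithinAt_iff_tendsto_slope.mp (hf.hasDerivAt.hasDerivWithinAt (s := Iio t))
  rw [show Iio t \ {t} = Iio t by simp] at h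
  refine ge_of_tendsto h ?_
  filter_upwards [self_mem_nhdsWithin] with s hs
  have hs' : s < t := hs
  rw [slope_def_field, le_div_iff_of_neg (by linarith)]
  linarith [hle s hs'.le]

/-- The barrier: a positive, coercive, strict supersolution of the heat equation on the slab,
for times before `t₀`. -/
noncomputable def slabBarrier {n : ℕ} (j : Fin n) (lam t₀ : ℝ)
    (p : EuclideanSpace ℝ (Fin n) × ℝ) : ℝ :=
  (n + 1) * (lam ^ 2 - p.1 j ^ 2) + ‖p.1‖ ^ 2 + (t₀ - p.2)

theorem continuous_slabBarrier {n : ℕ} (j : Fin n) (lam t₀ : ℝ) :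
    Continuous (slabBarrier j lam t₀) := by
  unfold slabBarrier
  fun_prop

theorem le_slabBarrier {n : ℕ} {j : Fin n} {lam t₀ : ℝ} {x : EuclideanSpace ℝ (Fin n)}
    (h0 : 0 ≤ x j) (h1 : x j ≤ lam) (t : ℝ) :
    ‖x‖ ^ 2 + (t₀ - t) ≤ slabBarrier j lam t₀ (x, t) := by
  have : 0 ≤ ((n : ℝ) + 1) * (lam ^ 2 - x j ^ 2) :=
    mul_nonneg (by positivity) (by nlinarith)
  simp only [slabBarrier]
  linarith

theorem slabBarrier_add_single {n : ℕ} (j i : Fin n) (lam t₀ t s : ℝ)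
    (x : EuclideanSpace ℝ (Fin n)) :
    slabBarrier j lam t₀ (x + s • EuclideanSpace.single i 1, t) =
      slabBarrier j lam t₀ (x, t)
        + (2 * x i - if i = j then 2 * (n + 1) * x j else 0) * s
        + (1 - if i = j then (n + 1 : ℝ) else 0) * s ^ 2 := by
  have hnorm : ‖x + s • EuclideanSpace.single i (1 : ℝ)‖ ^ 2 = ‖x‖ ^ 2 + 2 * x i * s + s ^ 2 := by
    rw [norm_add_sq_real, inner_smul_right, EuclideanSpace.inner_single_right, norm_smul]
    simp
    ring
  simp only [slabBarrier, hnorm]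
  by_cases hij : i = j
  · subst hij
    simp
    ring
  · simp [hij, Ne.symm hij]
    ring

/-- A function continuous and bounded above on the closed slab, minus a positive multiple of the
barrier, attains its maximum over times before `t₀`, provided it is positive somewhere. -/
theorem exists_max_sub_slabBarrier {n : ℕ} {j : Fin n} {lam t₀ M ε : ℝ} (hε : 0 < ε)
    {v : EuclideanSpace ℝ (Fin n) × ℝ → ℝ}
    (hcont : ContinuousOn v
      ({x : EuclideanSpace ℝ (Fin n) | 0 ≤ x j ∧ x j ≤ lam} ×ˢ (univ : Set ℝ)))
    (hM : ∀ x : EuclideanSpace ℝ (Fin n), 0 ≤ x j → x j ≤ lam → ∀ t : ℝ, v (x, t) ≤ M)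
    {x₀ : EuclideanSpace ℝ (Fin n)} (h0 : 0 ≤ x₀ j) (h1 : x₀ j ≤ lam)
    (hpos : 0 < v (x₀, t₀) - ε * slabBarrier j lam t₀ (x₀, t₀)) :
    ∃ (x : EuclideanSpace ℝ (Fin n)) (t : ℝ), 0 ≤ x j ∧ x j ≤ lam ∧ t ≤ t₀ ∧
      0 < v (x, t) - ε * slabBarrier j lam t₀ (x, t) ∧
      ∀ (y : EuclideanSpace ℝ (Fin n)) (s : ℝ), 0 ≤ y j → y j ≤ lam → s ≤ t₀ →
        v (y, s) - ε * slabBarrier j lam t₀ (y, s) ≤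
          v (x, t) - ε * slabBarrier j lam t₀ (x, t) := by
  set w : EuclideanSpace ℝ (Fin n) × ℝ → ℝ := fun p => v p - ε * slabBarrier j lam t₀ p with hw
  set R : ℝ := M / ε with hR
  set K : Set (EuclideanSpace ℝ (Fin n) × ℝ) :=
    {p | 0 ≤ p.1 j ∧ p.1 j ≤ lam ∧ p.2 ≤ t₀ ∧ ‖p.1‖ ^ 2 + (t₀ - p.2) ≤ R} with hK
  have hmem : ∀ (y : EuclideanSpace ℝ (Fin n)) (s : ℝ), 0 ≤ y j → y j ≤ lam → s ≤ t₀ →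
      0 < w (y, s) → (y, s) ∈ K := by
    intro y s hy0 hy1 hs hwpos
    refine ⟨hy0, hy1, hs, (le_slabBarrier hy0 hy1 s).trans ?_⟩
    rw [hR, le_div_iff₀ hε]
    have := hM y hy0 hy1 s
    simp only [hw] at hwpos
    linarith
  have hclosed : IsClosed K := by
    simp only [hK, ofPred_and]
    have hcoord : Continuous fun p : EuclideanSpace ℝ (Fin n) × ℝ => p.1 j := by fun_prop
    have hpar : Continuous fun p : EuclideanSpace ℝ (Fin n) × ℝ => ‖p.1‖ ^ 2 + (t₀ - p.2) := by
      fun_prop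
    exact (isClosed_le continuous_const hcoord).inter
      ((isClosed_le hcoord continuous_const).inter
        ((isClosed_le continuous_snd continuous_const).inter
          (isClosed_le hpar continuous_const)))
  have hcompact : IsCompact K := by
    refine ((isCompact_closedBall (0 : EuclideanSpace ℝ (Fin n)) (R + 1)).prod
      (isCompact_Icc (a := t₀ - R) (b := t₀))).of_isClosed_subset hclosed ?_
    rintro ⟨y, s⟩ ⟨-, -, hs, hb⟩
    simp only at hs hb
    refine ⟨?_, ?_, hs⟩
    · rw [mem_closedBall_zero_iff]
      nlinarith [sq_nonneg (‖y‖ - 1)]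
    · nlinarith [sq_nonneg ‖y‖]
  have hwcont : ContinuousOn w K := by
    refine (hcont.mono ?_).sub
      (continuous_const.mul (continuous_slabBarrier j lam t₀)).continuousOn
    rintro p ⟨hp0, hp1, -⟩
    exact ⟨⟨hp0, hp1⟩, mem_univ _⟩
  have hx₀ : (x₀, t₀) ∈ K := hmem x₀ t₀ h0 h1 le_rfl hpos
  obtain ⟨⟨x, t⟩, ⟨hx0, hx1, ht, -⟩, hmax⟩ := hcompact.exists_isMaxOn ⟨_, hx₀⟩ hwcont
  have hwpos : 0 < w (x, t) := hpos.trans_le (hmax hx₀)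
  refine ⟨x, t, hx0, hx1, ht, hwpos, fun y s hy0 hy1 hs => ?_⟩
  rcases le_or_gt (w (y, s)) 0 with h | h
  · exact h.trans hwpos.le
  · exact hmax (hmem y s hy0 hy1 hs h)

/-- Phragmén–Lindelöf type maximum principle in a slab: a bounded caloric function
on the slab `T_λ = {0 < x₁ < λ}` for all times `t ∈ ℝ`, nonpositive on the lateral
boundary `{x₁ = 0 or x₁ = λ}`, is nonpositive in the slab. -/
theorem slab_maximum_principle
    (n : ℕ) (hn : 0 < n) (lam : ℝ) (hlam : 0 < lam)
    (v : EuclideanSpace ℝ (Fin n) × ℝ → ℝ)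
    (hcont : ContinuousOn v
      ({x : EuclideanSpace ℝ (Fin n) | 0 ≤ x ⟨0, hn⟩ ∧ x ⟨0, hn⟩ ≤ lam}
        ×ˢ (univ : Set ℝ)))
    (hbdd : ∃ M : ℝ, ∀ x : EuclideanSpace ℝ (Fin n),
      0 ≤ x ⟨0, hn⟩ → x ⟨0, hn⟩ ≤ lam → ∀ t : ℝ, |v (x, t)| ≤ M)
    (hreg : ∀ t : ℝ, ContDiffOn ℝ 2 (fun x => v (x, t))
      {x : EuclideanSpace ℝ (Fin n) | 0 < x ⟨0, hn⟩ ∧ x ⟨0, hn⟩ < lam})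
    (hregt : ∀ x : EuclideanSpace ℝ (Fin n),
      0 < x ⟨0, hn⟩ → x ⟨0, hn⟩ < lam → ContDiff ℝ 1 fun s => v (x, s))
    (heq : ∀ x : EuclideanSpace ℝ (Fin n), 0 < x ⟨0, hn⟩ → x ⟨0, hn⟩ < lam →
      ∀ t : ℝ, deriv (fun s => v (x, s)) t = lap (fun y => v (y, t)) x)
    (hbc : ∀ x : EuclideanSpace ℝ (Fin n),
      (x ⟨0, hn⟩ = 0 ∨ x ⟨0, hn⟩ = lam) → ∀ t : ℝ, v (x, t) ≤ 0) :
    ∀ x : EuclideanSpace ℝ (Fin n), 0 < x ⟨0, hn⟩ → x ⟨0, hn⟩ < lam →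
      ∀ t : ℝ, v (x, t) ≤ 0 := by
  intro x₀ h0 h1 t₀
  by_contra! hv
  obtain ⟨M, hM⟩ := hbdd
  set j : Fin n := ⟨0, hn⟩
  have hψ : 0 ≤ slabBarrier j lam t₀ (x₀, t₀) :=
    le_trans (by simp) (le_slabBarrier h0.le h1.le t₀)
  obtain ⟨ε, hε, hεv⟩ : ∃ ε : ℝ, 0 < ε ∧ ε * slabBarrier j lam t₀ (x₀, t₀) < v (x₀, t₀) := by
    refine ⟨v (x₀, t₀) / (slabBarrier j lam t₀ (x₀, t₀) + 1), by positivity, ?_⟩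
    rw [div_mul_eq_mul_div, div_lt_iff₀ (by positivity)]
    nlinarith
  obtain ⟨x, t, hx0, hx1, ht, hpos, hmax⟩ := exists_max_sub_slabBarrier hε hcont
    (fun y hy0 hy1 s => (le_abs_self _).trans (hM y hy0 hy1 s)) h0.le h1.le (sub_pos.mpr hεv)
  have hvpos : 0 < v (x, t) := by
    have : 0 ≤ ε * slabBarrier j lam t₀ (x, t) :=
      mul_nonneg hε.le (le_trans (add_nonneg (by positivity) (sub_nonneg.mpr ht))
        (le_slabBarrier hx0 hx1 t))
    linarith
  have hx0' : 0 < x j := hx0.lt_of_ne fun h => hvpos.not_ge (hbc x (Or.inl h.symm) t)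
  have hx1' : x j < lam := hx1.lt_of_ne fun h => hvpos.not_ge (hbc x (Or.inr h) t)
  have htime : -ε ≤ deriv (fun s => v (x, s)) t := by
    refine le_deriv_of_le_affine_left ((hregt x hx0' hx1').differentiable (by simp) t)
      fun s hs => ?_
    have := hmax x s hx0 hx1 (hs.trans ht)
    simp only [slabBarrier] at this
    linarith
  have hopen : IsOpen {y : EuclideanSpace ℝ (Fin n) | 0 < y j ∧ y j < lam} := by
    have hcoord : Continuous fun y : EuclideanSpace ℝ (Fin n) => y j := by fun_prop
    exact (isOpen_lt continuous_const hcoord).inter (isOpen_lt hcoord continuous_const)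
  have hnhds : {y : EuclideanSpace ℝ (Fin n) | 0 < y j ∧ y j < lam} ∈ nhds x :=
    hopen.mem_nhds ⟨hx0', hx1'⟩
  have hspace : lap (fun y => v (y, t)) x ≤
      ∑ i : Fin n, 2 * (ε * (1 - if i = j then (n + 1 : ℝ) else 0)) := by
    refine Finset.sum_le_sum fun i _ => ?_
    refine fderiv_fderiv_le_of_le_quadratic
      (b := ε * (2 * x i - if i = j then 2 * (n + 1) * x j else 0))
      ((hreg t).contDiffAt hnhds) ?_
    have htend : Filter.Tendsto (fun s : ℝ => x + s • EuclideanSpace.single i (1 : ℝ))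
        (nhds 0) (nhds x) := by
      have : Continuous fun s : ℝ => x + s • EuclideanSpace.single i (1 : ℝ) := by fun_prop
      simpa using this.tendsto 0
    filter_upwards [htend hnhds] with s hs
    have := hmax _ t hs.1.le hs.2.le ht
    rw [slabBarrier_add_single] at this
    linarith
  have hsum : ∑ i : Fin n, 2 * (ε * (1 - if i = j then (n + 1 : ℝ) else 0)) = -(2 * ε) := by
    rw [← Finset.mul_sum, ← Finset.mul_sum, Finset.sum_sub_distrib]
    simp
  rw [heq x hx0' hx1' t] at htime
  linarith
end

section
/- Let n ≥ 1 and q > 1. Let u be a positive classical solution of the half-space problem ∂ₜu = Δu in ℝⁿ₊×ℝ, −∂u/∂x₁ = u^q on ∂ℝⁿ₊×ℝ, which is smooth in the open half-space and such that u and |∇u| are bounded on closure(ℝⁿ₊)×ℝ. Then ∂u/∂x₁(x,t) ≤ 0 for all x ∈ ℝⁿ₊ and t ∈ ℝ. -/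
open scoped BigOperators
open Set

/-- The open half-space `ℝⁿ₊ = {x : x₁ > 0}`. -/
def openHalf (n : ℕ) (hn : 0 < n) : Set (EuclideanSpace ℝ (Fin n)) :=
  {x | 0 < x ⟨0, hn⟩}

/-- The closed half-space `{x : x₁ ≥ 0}` (the closure of `ℝⁿ₊`). -/
def closedHalf (n : ℕ) (hn : 0 < n) : Set (EuclideanSpace ℝ (Fin n)) :=
  {x | 0 ≤ x ⟨0, hn⟩}

/-- `u` is a positive classical solution of the half-space problem
`∂ₜu = Δu` in `ℝⁿ₊ × ℝ`, `-∂u/∂x₁ = u^q` on `∂ℝⁿ₊ × ℝ`: it is continuous together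
with its spatial gradient up to the boundary, `C²` in `x` and `C¹` in `t` in the
open half-space, satisfies the heat equation inside and the nonlinear boundary
condition on the boundary, and is everywhere positive. -/
def IsHalfSpaceSol (n : ℕ) (hn : 0 < n) (q : ℝ)
    (u : EuclideanSpace ℝ (Fin n) × ℝ → ℝ) : Prop :=
  ContinuousOn u (closedHalf n hn ×ˢ (univ : Set ℝ)) ∧
  (∀ t, ContDiffOn ℝ 1 (fun x => u (x, t)) (closedHalf n hn)) ∧
  (∀ t, ContinuousOn
    (fun x => fderivWithin ℝ (fun y => u (y, t)) (closedHalf n hn) x)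
    (closedHalf n hn)) ∧
  (∀ t, ContDiffOn ℝ 2 (fun x => u (x, t)) (openHalf n hn)) ∧
  (∀ x ∈ openHalf n hn, ContDiff ℝ 1 fun s => u (x, s)) ∧
  (∀ x ∈ openHalf n hn, ∀ t : ℝ,
    deriv (fun s => u (x, s)) t = lap (fun y => u (y, t)) x) ∧
  (∀ x : EuclideanSpace ℝ (Fin n), x ⟨0, hn⟩ = 0 → ∀ t : ℝ,
    -(fderivWithin ℝ (fun y => u (y, t)) (closedHalf n hn) x
        (EuclideanSpace.single ⟨0, hn⟩ 1)) = u (x, t) ^ q) ∧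
  (∀ x ∈ closedHalf n hn, ∀ t : ℝ, 0 < u (x, t))

theorem hasDerivAt_quadratic (A B s : ℝ) :
    HasDerivAt (fun s : ℝ => A * s ^ 2 + B * s) (2 * A * s + B) s := by
  refine (((hasDerivAt_pow 2 s).const_mul A).add ((hasDerivAt_id s).const_mul B)).congr_deriv ?_
  norm_num
  ring

/-- Second derivative test along a line, with a quadratic correction. -/
theorem second_deriv_le_of_sub_quadratic_le {ψ ψ' : ℝ → ℝ} {A B c : ℝ}
    (h1 : ∀ᶠ s in nhds 0, HasDerivAt ψ (ψ' s) s) (h2 : HasDerivAt ψ' c 0)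
    (hmax : ∀ᶠ s in nhds 0, ψ s - (A * s ^ 2 + B * s) ≤ ψ 0) : c ≤ 2 * A := by
  by_contra! hc
  set φ : ℝ → ℝ := fun s => ψ s - (A * s ^ 2 + B * s) with hφ
  have hd : ∀ᶠ s in nhds 0, HasDerivAt φ (ψ' s - (2 * A * s + B)) s := by
    filter_upwards [h1] with s hs using hs.sub (hasDerivAt_quadratic A B s)
  have hd' : deriv φ =ᶠ[nhds 0] fun s => ψ' s - (2 * A * s + B) :=
    hd.mono fun s hs => hs.deriv
  have hd2 : HasDerivAt (deriv φ) (c - 2 * A) 0 := by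
    have h3 : HasDerivAt (fun s : ℝ => ψ' s - (2 * A * s + B)) (c - 2 * A) 0 := by
      refine (h2.sub (((hasDerivAt_id (0 : ℝ)).const_mul (2 * A)).add_const B)).congr_deriv ?_
      simp
    exact h3.congr_of_eventuallyEq hd'
  have hlmax : IsLocalMax φ 0 := by
    filter_upwards [hmax] with s hs
    simpa [hφ] using hs
  have hlmin : IsLocalMin φ 0 :=
    isLocalMin_of_deriv_deriv_pos (by rw [hd2.deriv]; linarith) hlmax.deriv_eq_zero
      hd.self_of_nhds.continuousAt
  have hconst : φ =ᶠ[nhds 0] fun _ => φ 0 := by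
    filter_upwards [hlmax, hlmin] with s ha hb using le_antisymm ha hb
  have hz : deriv φ =ᶠ[nhds 0] fun _ => 0 := by
    filter_upwards [hconst.eventuallyEq_nhds] with s hs
    rw [hs.deriv_eq, deriv_const]
  have := hd2.deriv
  rw [hz.deriv_eq, deriv_const] at this
  linarith

/-- A function maximal at the right end of an interval has nonnegative derivative there. -/
theorem deriv_nonneg_of_left_max {f : ℝ → ℝ} {c a t : ℝ} (hat : a < t)
    (hf : HasDerivAt f c t) (hmax : ∀ s ∈ Icc a t, f s ≤ f t) : 0 ≤ c := by
  have h := (hf.hasDerivWithinAt (s := Iio t))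
  rw [hasDerivWithinAt_iff_tendsto_slope' (by simp)] at h
  refine ge_of_tendsto h ?_
  filter_upwards [Ioo_mem_nhdsLT hat] with s hs
  rw [slope_def_field]
  exact div_nonneg_of_nonpos (by linarith [hmax s ⟨hs.1.le, hs.2.le⟩]) (by linarith [hs.2])

/-- A function maximal at the left end of an interval has nonpositive right derivative there. -/
theorem deriv_nonpos_of_right_max {f : ℝ → ℝ} {c b : ℝ} (hb : 0 < b)
    (hf : HasDerivWithinAt f c (Ici 0) 0) (hmax : ∀ s ∈ Icc 0 b, f s ≤ f 0) : c ≤ 0 := by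
  have h := hf.mono Ioi_subset_Ici_self
  rw [hasDerivWithinAt_iff_tendsto_slope' (by simp)] at h
  refine le_of_tendsto h ?_
  filter_upwards [Ioo_mem_nhdsGT hb] with s hs
  rw [slope_def_field]
  exact div_nonpos_of_nonpos_of_nonneg (by linarith [hmax s ⟨hs.1.le, hs.2.le⟩]) (by linarith [hs.1])

section Lines

variable {E : Type*} [NormedAddCommGroup E] [NormedSpace ℝ E]

theorem eventually_hasDerivAt_line {Ω : Set E} (hΩ : IsOpen Ω) {f : E → ℝ}
    (hf : ContDiffOn ℝ 2 f Ω) {x : E} (hx : x ∈ Ω) (e : E) :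
    ∀ᶠ s : ℝ in nhds 0, HasDerivAt (fun s : ℝ => f (x + s • e)) (fderiv ℝ f (x + s • e) e) s := by
  have hc : Continuous fun s : ℝ => x + s • e := by fun_prop
  have hm : ∀ᶠ s : ℝ in nhds 0, x + s • e ∈ Ω :=
    hc.continuousAt.eventually (by simpa using hΩ.mem_nhds hx)
  filter_upwards [hm] with s hs
  have hd : HasFDerivAt f (fderiv ℝ f (x + s • e)) (x + s • e) :=
    ((hf.contDiffAt (hΩ.mem_nhds hs)).differentiableAt (by norm_num)).hasFDerivAt
  have hl : HasDerivAt (fun s : ℝ => x + s • e) e s := by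
    simpa using ((hasDerivAt_id s).smul_const e).const_add x
  exact hd.comp_hasDerivAt s hl

theorem hasDerivAt_fderiv_line {Ω : Set E} (hΩ : IsOpen Ω) {f : E → ℝ}
    (hf : ContDiffOn ℝ 2 f Ω) {x : E} (hx : x ∈ Ω) (e : E) :
    HasDerivAt (fun s : ℝ => fderiv ℝ f (x + s • e) e)
      (fderiv ℝ (fun y => fderiv ℝ f y e) x e) 0 := by
  have h1 : ContDiffAt ℝ 1 (fderiv ℝ f) x :=
    (hf.contDiffAt (hΩ.mem_nhds hx)).fderiv_right (by norm_num)
  have h2 : DifferentiableAt ℝ (fun y => fderiv ℝ f y e) x :=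
    (h1.differentiableAt (by norm_num)).clm_apply (differentiableAt_const e)
  have hl : HasDerivAt (fun s : ℝ => x + s • e) e 0 := by
    simpa using ((hasDerivAt_id (0 : ℝ)).smul_const e).const_add x
  have h3 : HasFDerivAt (fun y => fderiv ℝ f y e) (fderiv ℝ (fun y => fderiv ℝ f y e) x)
      (x + (0 : ℝ) • e) := by simpa using h2.hasFDerivAt
  exact h3.comp_hasDerivAt 0 hl

end Lines

theorem isOpen_openHalf (n : ℕ) (hn : 0 < n) : IsOpen (openHalf n hn) :=
  isOpen_lt continuous_const (by fun_prop)

theorem isClosed_closedHalf (n : ℕ) (hn : 0 < n) : IsClosed (closedHalf n hn) :=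
  isClosed_le continuous_const (by fun_prop)

theorem norm_add_smul_single_sq {n : ℕ} (x : EuclideanSpace ℝ (Fin n)) (i : Fin n) (s : ℝ) :
    ‖x + s • EuclideanSpace.single i (1 : ℝ)‖ ^ 2 = ‖x‖ ^ 2 + (s ^ 2 + 2 * x i * s) := by
  rw [norm_add_sq_real, norm_smul, inner_smul_right]
  simp [EuclideanSpace.inner_single_right]
  ring

/-- The increment of `u` over distance `h` in the `x₁` direction minus the comparison function. -/
noncomputable def excess {n : ℕ} (e : EuclideanSpace ℝ (Fin n)) (M R ε a : ℝ)
    (u : EuclideanSpace ℝ (Fin n) × ℝ → ℝ) (x : EuclideanSpace ℝ (Fin n)) (h t : ℝ) : ℝ :=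
  u (x + h • e, t) - u (x, t) - M * h / R
    - M * Real.exp (-(2 / R ^ 2) * (t - a)) * (1 + (2 * R * h - h ^ 2) / R ^ 2)
    - ε * (‖x‖ ^ 2 + (2 * n + 1) * (t - a))

section Comparison

variable {n : ℕ} {hn : 0 < n} {q : ℝ} {u : EuclideanSpace ℝ (Fin n) × ℝ → ℝ}

theorem add_smul_mem_closedHalf {x : EuclideanSpace ℝ (Fin n)} (hx : x ∈ closedHalf n hn)
    {h : ℝ} (hh : 0 ≤ h) : x + h • EuclideanSpace.single ⟨0, hn⟩ (1 : ℝ) ∈ closedHalf n hn := by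
  simp only [closedHalf, mem_ofPred_eq] at hx ⊢
  simpa using add_nonneg hx hh

/-- The excess attains no nonnegative maximum. -/
theorem excess_maximum_false (hsol : IsHalfSpaceSol n hn q u) {M R ε a b : ℝ}
    (hM : ∀ x ∈ closedHalf n hn, ∀ t, u (x, t) ≤ M) (hM0 : 0 < M) (hR : 0 < R) (hε : 0 < ε)
    {x : EuclideanSpace ℝ (Fin n)} {h t : ℝ} (hx : x ∈ closedHalf n hn) (hh : h ∈ Icc 0 R)
    (ht : t ∈ Icc a b)
    (hF : 0 ≤ excess (EuclideanSpace.single ⟨0, hn⟩ 1) M R ε a u x h t)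
    (hmax : ∀ y ∈ closedHalf n hn, ∀ k ∈ Icc 0 R, ∀ s ∈ Icc a b,
      excess (EuclideanSpace.single ⟨0, hn⟩ 1) M R ε a u y k s ≤
        excess (EuclideanSpace.single ⟨0, hn⟩ 1) M R ε a u x h t) : False := by
  obtain ⟨-, hC1, -, hC2, htime, hheat, hbc, hpos⟩ := hsol
  set e : EuclideanSpace ℝ (Fin n) := EuclideanSpace.single ⟨0, hn⟩ 1 with he
  have hxe : x + h • e ∈ closedHalf n hn := add_smul_mem_closedHalf hx hh.1
  have hWM : u (x + h • e, t) - u (x, t) < M := by linarith [hM _ hxe t, hpos x hx t]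
  have hg : 0 ≤ (2 * R * h - h ^ 2) / R ^ 2 := by
    refine div_nonneg ?_ (by positivity)
    nlinarith [hh.1, hh.2]
  have hpen : 0 ≤ ε * (‖x‖ ^ 2 + (2 * n + 1) * (t - a)) := by
    have : 0 ≤ t - a := by linarith [ht.1]
    positivity
  have hMh : 0 ≤ M * h / R := div_nonneg (mul_nonneg hM0.le hh.1) hR.le
  have hbar : 0 < M * Real.exp (-(2 / R ^ 2) * (t - a)) * (1 + (2 * R * h - h ^ 2) / R ^ 2) := by
    positivity
  have hh0 : 0 < h := by
    refine lt_of_le_of_ne hh.1 fun h0 => ?_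
    subst h0
    simp only [excess, zero_smul, add_zero] at hF
    linarith
  have hhR : h < R := by
    refine lt_of_le_of_ne hh.2 fun h0 => ?_
    subst h0
    have : M * h / h = M := by field_simp
    simp only [excess] at hF
    linarith
  have hta : a < t := by
    refine lt_of_le_of_ne ht.1 fun h0 => ?_
    subst h0
    simp only [excess, sub_self, mul_zero, Real.exp_zero, mul_one] at hF hpen
    have : 0 ≤ M * ((2 * R * h - h ^ 2) / R ^ 2) := mul_nonneg hM0.le hg
    linarith
  set L := M * Real.exp (-(2 / R ^ 2) * (t - a)) with hL
  have hL0 : 0 < L := by positivity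
  have hgd : 0 < (2 * R - 2 * h) / R ^ 2 := div_pos (by linarith) (by positivity)
  -- moving the lower endpoint towards the upper one
  have hmove : ∀ s : ℝ, excess e M R ε a u (x + s • e) (h - s) t
      = -u (x + s • e, t) - ((-L / R ^ 2 + ε) * s ^ 2
          + (-M / R - L * ((2 * R - 2 * h) / R ^ 2) + 2 * ε * x ⟨0, hn⟩) * s)
        + (excess e M R ε a u x h t + u (x, t)) := by
    intro s
    have h1 : x + s • e + (h - s) • e = x + h • e := by module
    have h2 : ‖x + s • e‖ ^ 2 = ‖x‖ ^ 2 + (s ^ 2 + 2 * x ⟨0, hn⟩ * s) :=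
      norm_add_smul_single_sq x ⟨0, hn⟩ s
    simp only [excess, h1, h2, ← hL]
    field_simp
    ring
  have hmove_mem : ∀ s : ℝ, x + s • e ∈ closedHalf n hn → h - s ∈ Icc 0 R →
      -u (x + s • e, t) - ((-L / R ^ 2 + ε) * s ^ 2
          + (-M / R - L * ((2 * R - 2 * h) / R ^ 2) + 2 * ε * x ⟨0, hn⟩) * s) ≤ -u (x, t) := by
    intro s h1 h2
    have := hmax _ h1 _ h2 t ht
    rw [hmove] at this
    linarith
  rcases (show 0 ≤ x ⟨0, hn⟩ from hx).eq_or_lt with hx0 | hx0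
  · have hd : HasFDerivWithinAt (fun y => u (y, t))
        (fderivWithin ℝ (fun y => u (y, t)) (closedHalf n hn) x) (closedHalf n hn)
        (x + (0 : ℝ) • e) := by
      simpa using ((hC1 t).differentiableOn (by norm_num) x hx).hasFDerivWithinAt
    have hl : HasDerivWithinAt (fun s : ℝ => x + s • e) e (Ici 0) 0 := by
      simpa using (((hasDerivAt_id (0 : ℝ)).smul_const e).const_add x).hasDerivWithinAt
    have hd1 := hd.comp_hasDerivWithinAt 0 hl fun s hs => add_smul_mem_closedHalf hx hs
    have hb : fderivWithin ℝ (fun y => u (y, t)) (closedHalf n hn) x e = -u (x, t) ^ q := by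
      linarith [hbc x hx0.symm t]
    rw [hb] at hd1
    have hup : 0 < u (x, t) ^ q := Real.rpow_pos_of_pos (hpos x hx t) q
    set A := -L / R ^ 2 + ε
    set B := -M / R - L * ((2 * R - 2 * h) / R ^ 2) + 2 * ε * x ⟨0, hn⟩ with hB
    have hB0 : B < 0 := by
      have h1 : 0 < M / R := by positivity
      have h2 : 0 < L * ((2 * R - 2 * h) / R ^ 2) := by positivity
      rw [hB, ← hx0, neg_div]
      linarith
    have hp : HasDerivAt (fun s : ℝ => A * s ^ 2 + B * s) B 0 := by
      simpa using hasDerivAt_quadratic A B 0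
    have := deriv_nonpos_of_right_max hh0 (hd1.neg.sub hp.hasDerivWithinAt) (by
      intro s hs
      have := hmove_mem s (add_smul_mem_closedHalf hx hs.1) ⟨by linarith [hs.2], by linarith [hs.1]⟩
      simpa using this)
    linarith
  · have hxo : x ∈ openHalf n hn := hx0
    have hyo : x + h • e ∈ openHalf n hn := by
      simp only [openHalf, mem_ofPred_eq]
      simpa [he] using add_pos hx0 hh0
    have hΩ := isOpen_openHalf n hn
    have hinc : openHalf n hn ⊆ closedHalf n hn := fun z hz =>
      le_of_lt (show 0 < z ⟨0, hn⟩ from hz)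
    have hnear : ∀ i : Fin n, ∀ᶠ s : ℝ in nhds 0,
        x + s • EuclideanSpace.single i (1 : ℝ) ∈ closedHalf n hn := by
      intro i
      have hc : Continuous fun s : ℝ => x + s • EuclideanSpace.single i (1 : ℝ) := by fun_prop
      exact (hc.continuousAt.eventually (by simpa using hΩ.mem_nhds hxo)).mono fun s hs => hinc hs
    set D : EuclideanSpace ℝ (Fin n) → Fin n → ℝ := fun z i =>
      fderiv ℝ (fun y => fderiv ℝ (fun y => u (y, t)) y (EuclideanSpace.single i 1)) z
        (EuclideanSpace.single i 1) with hD
    have hlow : -D x ⟨0, hn⟩ ≤ 2 * (-L / R ^ 2 + ε) := by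
      refine second_deriv_le_of_sub_quadratic_le
        (B := -M / R - L * ((2 * R - 2 * h) / R ^ 2) + 2 * ε * x ⟨0, hn⟩)
        ((eventually_hasDerivAt_line hΩ (hC2 t) hxo e).mono fun s hs => hs.neg)
        (hasDerivAt_fderiv_line hΩ (hC2 t) hxo e).neg ?_
      have hc : Continuous fun s : ℝ => h - s := by fun_prop
      have h2 : ∀ᶠ s : ℝ in nhds 0, h - s ∈ Icc 0 R :=
        hc.continuousAt.eventually_mem (by rw [sub_zero]; exact Icc_mem_nhds hh0 hhR)
      filter_upwards [hnear ⟨0, hn⟩, h2] with s hs1 hs2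
      simpa using hmove_mem s hs1 hs2
    have hupp : D (x + h • e) ⟨0, hn⟩ ≤ 2 * (-L / R ^ 2) := by
      refine second_deriv_le_of_sub_quadratic_le (B := M / R + L * ((2 * R - 2 * h) / R ^ 2))
        (eventually_hasDerivAt_line hΩ (hC2 t) hyo e)
        (hasDerivAt_fderiv_line hΩ (hC2 t) hyo e) ?_
      have hc : Continuous fun s : ℝ => h + s := by fun_prop
      have h2 : ∀ᶠ s : ℝ in nhds 0, h + s ∈ Icc 0 R :=
        hc.continuousAt.eventually_mem (by rw [add_zero]; exact Icc_mem_nhds hh0 hhR)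
      filter_upwards [h2] with s hs
      have h3 := hmax x hx _ hs t ht
      have h4 : excess e M R ε a u x (h + s) t = u (x + h • e + s • e, t)
          - ((-L / R ^ 2) * s ^ 2 + (M / R + L * ((2 * R - 2 * h) / R ^ 2)) * s)
          + (excess e M R ε a u x h t - u (x + h • e, t)) := by
        have h1 : x + (h + s) • e = x + h • e + s • e := by module
        simp only [excess, h1, ← hL]
        field_simp
        ring
      rw [h4] at h3
      simp only [zero_smul, add_zero]
      linarith
    have htan : ∀ i, D (x + h • e) i - D x i ≤ 2 * ε := by
      intro i
      refine second_deriv_le_of_sub_quadratic_le (B := 2 * ε * x i)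
        (((eventually_hasDerivAt_line hΩ (hC2 t) hyo (EuclideanSpace.single i 1)).and
          (eventually_hasDerivAt_line hΩ (hC2 t) hxo (EuclideanSpace.single i 1))).mono
            fun s hs => hs.1.sub hs.2)
        ((hasDerivAt_fderiv_line hΩ (hC2 t) hyo _).sub
          (hasDerivAt_fderiv_line hΩ (hC2 t) hxo _)) ?_
      filter_upwards [hnear i] with s hs
      have h3 := hmax _ hs h hh t ht
      have h1 : x + s • EuclideanSpace.single i (1 : ℝ) + h • e
          = x + h • e + s • EuclideanSpace.single i (1 : ℝ) := by module
      simp only [excess, h1, norm_add_smul_single_sq] at h3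
      simp only [Pi.sub_apply, zero_smul, add_zero]
      linarith
    have hlap : lap (fun y => u (y, t)) (x + h • e) - lap (fun y => u (y, t)) x
        ≤ 2 * (-L / R ^ 2) + 2 * (-L / R ^ 2) + 2 * n * ε := by
      have h1 : lap (fun y => u (y, t)) (x + h • e) - lap (fun y => u (y, t)) x
          = ∑ i, (D (x + h • e) i - D x i) := by
        rw [Finset.sum_sub_distrib]; rfl
      rw [h1, ← Finset.add_sum_erase _ _ (Finset.mem_univ (⟨0, hn⟩ : Fin n))]
      have h2 : ∑ i ∈ Finset.univ.erase (⟨0, hn⟩ : Fin n), (D (x + h • e) i - D x i)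
          ≤ (n - 1) * (2 * ε) := by
        refine (Finset.sum_le_card_nsmul _ _ _ fun i _ => htan i).trans_eq ?_
        rw [Finset.card_erase_of_mem (Finset.mem_univ _), nsmul_eq_mul, Finset.card_fin,
          Nat.cast_sub hn, Nat.cast_one]
      linarith
    have hdt : ∀ z ∈ openHalf n hn,
        HasDerivAt (fun s => u (z, s)) (lap (fun y => u (y, t)) z) t := by
      intro z hz
      rw [← hheat z hz t]
      exact ((htime z hz).differentiable (by norm_num) t).hasDerivAt
    have hE : HasDerivAt (fun s => M * Real.exp (-(2 / R ^ 2) * (s - a)))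
        (L * (-(2 / R ^ 2))) t := by
      refine (((((hasDerivAt_id t).sub_const a).const_mul
        (-(2 / R ^ 2))).exp).const_mul M).congr_deriv ?_
      simp only [hL, id_eq]
      ring
    have hP : HasDerivAt (fun s => ε * (‖x‖ ^ 2 + (2 * n + 1) * (s - a))) (ε * (2 * n + 1)) t := by
      have := ((((hasDerivAt_id t).sub_const a).const_mul (2 * n + 1 : ℝ)).const_add
        (‖x‖ ^ 2)).const_mul ε
      simpa using this
    have hFt := deriv_nonneg_of_left_max hta
      (((((hdt _ hyo).sub (hdt _ hxo)).sub_const (M * h / R)).sub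
        (hE.mul_const (1 + (2 * R * h - h ^ 2) / R ^ 2))).sub hP)
      (fun s hs => hmax x hx h hh s ⟨hs.1, hs.2.trans ht.2⟩)
    have hg1 : (2 * R * h - h ^ 2) / R ^ 2 ≤ 1 := by
      rw [div_le_one (by positivity)]
      nlinarith [sq_nonneg (R - h)]
    have hkey : L * (2 / R ^ 2) * ((2 * R * h - h ^ 2) / R ^ 2) ≤ L * (2 / R ^ 2) * 1 :=
      mul_le_mul_of_nonneg_left hg1 (by positivity)
    have hr : -L / R ^ 2 = -(L * (2 / R ^ 2)) / 2 := by ring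
    rw [hr] at hlap
    linarith

theorem continuousOn_excess (hcont : ContinuousOn u (closedHalf n hn ×ˢ univ)) (M R ε a b : ℝ) :
    ContinuousOn (fun p : EuclideanSpace ℝ (Fin n) × ℝ × ℝ =>
      excess (EuclideanSpace.single ⟨0, hn⟩ 1) M R ε a u p.1 p.2.1 p.2.2)
      (closedHalf n hn ×ˢ Icc 0 R ×ˢ Icc a b) := by
  have h1 : ContinuousOn (fun p : EuclideanSpace ℝ (Fin n) × ℝ × ℝ =>
      u (p.1 + p.2.1 • EuclideanSpace.single ⟨0, hn⟩ 1, p.2.2))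
      (closedHalf n hn ×ˢ Icc 0 R ×ˢ Icc a b) :=
    hcont.comp (by fun_prop) fun p hp => ⟨add_smul_mem_closedHalf hp.1 hp.2.1.1, mem_univ _⟩
  have h2 : ContinuousOn (fun p : EuclideanSpace ℝ (Fin n) × ℝ × ℝ => u (p.1, p.2.2))
      (closedHalf n hn ×ˢ Icc 0 R ×ˢ Icc a b) :=
    hcont.comp (by fun_prop) fun p hp => ⟨hp.1, mem_univ _⟩
  have h3 : Continuous fun p : EuclideanSpace ℝ (Fin n) × ℝ × ℝ => M * p.2.1 / R := by fun_prop
  have h4 : Continuous fun p : EuclideanSpace ℝ (Fin n) × ℝ × ℝ =>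
      M * Real.exp (-(2 / R ^ 2) * (p.2.2 - a)) *
        (1 + (2 * R * p.2.1 - p.2.1 ^ 2) / R ^ 2) := by fun_prop
  have h5 : Continuous fun p : EuclideanSpace ℝ (Fin n) × ℝ × ℝ =>
      ε * (‖p.1‖ ^ 2 + (2 * n + 1) * (p.2.2 - a)) := by fun_prop
  exact (((h1.sub h2).sub h3.continuousOn).sub h4.continuousOn).sub h5.continuousOn

theorem excess_neg (hsol : IsHalfSpaceSol n hn q u) {M R ε a b : ℝ}
    (hM : ∀ x ∈ closedHalf n hn, ∀ t, u (x, t) ≤ M) (hM0 : 0 < M) (hR : 0 < R) (hε : 0 < ε)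
    {x : EuclideanSpace ℝ (Fin n)} {h t : ℝ} (hx : x ∈ closedHalf n hn) (hh : h ∈ Icc 0 R)
    (ht : t ∈ Icc a b) :
    excess (EuclideanSpace.single ⟨0, hn⟩ 1) M R ε a u x h t < 0 := by
  by_contra! hF
  have hsmall : ∀ y ∈ closedHalf n hn, ∀ k ∈ Icc 0 R, ∀ s ∈ Icc a b,
      0 ≤ excess (EuclideanSpace.single ⟨0, hn⟩ 1) M R ε a u y k s → ‖y‖ ≤ √(M / ε) := by
    intro y hy k hk s hs hFy
    have h1 := hM _ (add_smul_mem_closedHalf hy hk.1) s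
    have h2 := hsol.2.2.2.2.2.2.2 y hy s
    have h3 : 0 ≤ (2 * R * k - k ^ 2) / R ^ 2 := by
      refine div_nonneg ?_ (by positivity)
      nlinarith [hk.1, hk.2]
    have h4 : 0 ≤ M * Real.exp (-(2 / R ^ 2) * (s - a)) * (1 + (2 * R * k - k ^ 2) / R ^ 2) := by
      positivity
    have h5 : 0 ≤ M * k / R := div_nonneg (mul_nonneg hM0.le hk.1) hR.le
    have h6 : 0 ≤ ε * ((2 * n + 1) * (s - a)) := by
      have : 0 ≤ s - a := by linarith [hs.1]
      positivity
    refine Real.le_sqrt_of_sq_le ?_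
    rw [le_div_iff₀ hε]
    simp only [excess] at hFy
    linarith
  obtain ⟨⟨y, k, s⟩, hp, hpmax⟩ :=
    (((isCompact_closedBall (0 : EuclideanSpace ℝ (Fin n)) √(M / ε)).inter_left
      (isClosed_closedHalf n hn)).prod (isCompact_Icc (a := (0 : ℝ)) (b := R)|>.prod
        (isCompact_Icc (a := a) (b := b)))).exists_isMaxOn
      ⟨(x, h, t), ⟨hx, by simpa using hsmall x hx h hh t ht hF⟩, hh, ht⟩
      ((continuousOn_excess hsol.1 M R ε a b).mono
        (prod_mono_left inter_subset_left))
  have hF' := hF.trans (hpmax (a := (x, h, t)) ⟨⟨hx, by simpa using hsmall x hx h hh t ht hF⟩, hh, ht⟩)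
  refine excess_maximum_false hsol hM hM0 hR hε hp.1.1 hp.2.1 hp.2.2 hF' ?_
  intro y' hy' k' hk' s' hs'
  rcases le_total 0 (excess (EuclideanSpace.single ⟨0, hn⟩ 1) M R ε a u y' k' s') with h0 | h0
  · exact hpmax (a := (y', k', s')) ⟨⟨hy', by simpa using hsmall y' hy' k' hk' s' hs' h0⟩, hk', hs'⟩
  · exact h0.trans hF'

theorem le_of_translate (hsol : IsHalfSpaceSol n hn q u) {M : ℝ}
    (hM : ∀ x ∈ closedHalf n hn, ∀ t, u (x, t) ≤ M)
    {x : EuclideanSpace ℝ (Fin n)} (hx : x ∈ closedHalf n hn) {h : ℝ} (hh : 0 ≤ h) (t : ℝ) :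
    u (x + h • EuclideanSpace.single ⟨0, hn⟩ (1 : ℝ), t) ≤ u (x, t) := by
  have hM0 : 0 < M := (hsol.2.2.2.2.2.2.2 x hx t).trans_le (hM x hx t)
  set W := u (x + h • EuclideanSpace.single ⟨0, hn⟩ (1 : ℝ), t) - u (x, t) with hW
  have h1 : ∀ R > 0, h ≤ R → ∀ T ≥ 0, ∀ ε > 0,
      W ≤ M * h / R + M * Real.exp (-(2 / R ^ 2) * T) * (1 + (2 * R * h - h ^ 2) / R ^ 2)
        + ε * (‖x‖ ^ 2 + (2 * n + 1) * T) := by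
    intro R hR hhR T hT ε hε
    have := excess_neg hsol hM hM0 hR hε (a := t - T) (b := t) hx ⟨hh, hhR⟩
      ⟨by linarith, le_rfl⟩
    simp only [excess, sub_sub_cancel] at this
    linarith
  have h2 : ∀ R > 0, h ≤ R → ∀ T ≥ 0,
      W ≤ M * h / R + M * Real.exp (-(2 / R ^ 2) * T) * (1 + (2 * R * h - h ^ 2) / R ^ 2) := by
    intro R hR hhR T hT
    have hc : Continuous fun ε : ℝ => M * h / R
        + M * Real.exp (-(2 / R ^ 2) * T) * (1 + (2 * R * h - h ^ 2) / R ^ 2)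
        + ε * (‖x‖ ^ 2 + (2 * n + 1) * T) := by fun_prop
    have hl := (hc.tendsto 0).mono_left (nhdsWithin_le_nhds (s := Ioi 0))
    simp only [zero_mul, add_zero] at hl
    exact ge_of_tendsto hl (Filter.eventually_of_mem self_mem_nhdsWithin (h1 R hR hhR T hT))
  have h3 : ∀ R > 0, h ≤ R → W ≤ M * h / R := by
    intro R hR hhR
    have hl : Filter.Tendsto (fun T : ℝ => Real.exp (-(2 / R ^ 2) * T)) Filter.atTop (nhds 0) :=
      Real.tendsto_exp_atBot.comp
        (Filter.tendsto_id.const_mul_atTop_of_neg (by simpa using (by positivity)))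
    have hl2 := ((hl.const_mul M).mul_const (1 + (2 * R * h - h ^ 2) / R ^ 2)).const_add (M * h / R)
    simp only [mul_zero, zero_mul, add_zero] at hl2
    exact ge_of_tendsto hl2 ((Filter.eventually_ge_atTop 0).mono fun T hT => h2 R hR hhR T hT)
  have hl : Filter.Tendsto (fun R : ℝ => M * h / R) Filter.atTop (nhds 0) :=
    tendsto_const_nhds.div_atTop Filter.tendsto_id
  have hW0 : W ≤ 0 := ge_of_tendsto hl (by
    filter_upwards [Filter.eventually_gt_atTop 0, Filter.eventually_ge_atTop h] with R hR hhR
      using h3 R hR hhR)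
  linarith

end Comparison

/-- Monotonicity in `x₁`: a positive classical solution of the half-space problem
which is smooth in the open half-space and has `u` and `|∇u|` bounded on the
closed half-space satisfies `∂u/∂x₁ ≤ 0` in the open half-space. -/
theorem halfspace_solution_monotone
    (n : ℕ) (hn : 0 < n) (q : ℝ) (hq : 1 < q)
    (u : EuclideanSpace ℝ (Fin n) × ℝ → ℝ)
    (hsol : IsHalfSpaceSol n hn q u)
    (hsmooth : ContDiffOn ℝ (⊤ : ℕ∞) u (openHalf n hn ×ˢ (univ : Set ℝ)))
    (hbdd : ∃ M : ℝ, ∀ x ∈ closedHalf n hn, ∀ t : ℝ,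
      u (x, t) ≤ M ∧
      ‖fderivWithin ℝ (fun y => u (y, t)) (closedHalf n hn) x‖ ≤ M) :
    ∀ x ∈ openHalf n hn, ∀ t : ℝ,
      fderiv ℝ (fun y => u (y, t)) x (EuclideanSpace.single ⟨0, hn⟩ 1) ≤ 0 := by
  intro x hx t
  obtain ⟨M, hM⟩ := hbdd
  have hd := (eventually_hasDerivAt_line (isOpen_openHalf n hn) (hsol.2.2.2.1 t) hx
    (EuclideanSpace.single ⟨0, hn⟩ (1 : ℝ))).self_of_nhds
  rw [zero_smul, add_zero] at hd
  refine deriv_nonpos_of_right_max one_pos hd.hasDerivWithinAt fun s hs => ?_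
  have hx' : x ∈ closedHalf n hn := le_of_lt (show 0 < x ⟨0, hn⟩ from hx)
  simpa using le_of_translate hsol (fun x hx t => (hM x hx t).1) hx' hs.1 t
end
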